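/- For every fixed-point symbol σ ∈ {μ, ν}, every variable X ∈ 𝒳 and every expression e, there exists an expression e' with X ∉ occ(e') such that σ X = e ≡ σ X = e'. -/

import Mathlib

namespace RESpaper

noncomputable section

/-- Addition on the extended reals in which `⊤` (i.e. `∞`) dominates. -/
def eadd (x y : EReal) : EReal := if x = ⊤ ∨ y = ⊤ then ⊤ else x + y

/-- The operator `eq-∞`. -/
def eqNegInfVal (x : EReal) : EReal := if x = ⊥ then ⊥ else ⊤

/-- The operator `eq∞`. -/
def eqInfVal (x : EReal) : EReal := if x = ⊤ then ⊤ else ⊥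

open Classical in
/-- The sum, with respect to `eadd`, of a finite family of extended reals. -/
def eSum {ι : Type*} (s : Finset ι) (e : ι → EReal) : EReal :=
  if ∃ i ∈ s, e i = ⊤ then ⊤ else ∑ i ∈ s, e i

/-- Syntax of expressions over a set `V` of variables. -/
inductive Expr (V : Type*) where
  | var : V → Expr V
  | const : EReal → Expr V
  | scale : {c : ℝ // 0 < c} → Expr V → Expr V
  | add : Expr V → Expr V → Expr V
  | emin : Expr V → Expr V → Expr V
  | emax : Expr V → Expr V → Expr V
  | condL : Expr V → Expr V → Expr V → Expr V   -- (e₁ ⇒ e₂ ◇ e₃)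
  | condR : Expr V → Expr V → Expr V → Expr V   -- (e₁ → e₂ ◇ e₃)
  | eqm : Expr V → Expr V                       -- eq-∞(e)

variable {V : Type*}

/-- Evaluation of an expression under a valuation `η`. -/
def Expr.eval (η : V → EReal) : Expr V → EReal
  | var X => η X
  | const d => d
  | scale c e => (c.1 : EReal) * Expr.eval η e
  | add e₁ e₂ => eadd (Expr.eval η e₁) (Expr.eval η e₂)
  | emin e₁ e₂ => Expr.eval η e₁ ⊓ Expr.eval η e₂
  | emax e₁ e₂ => Expr.eval η e₁ ⊔ Expr.eval η e₂
  | condL e₁ e₂ e₃ =>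
      if Expr.eval η e₁ ≤ 0 then Expr.eval η e₂ ⊓ Expr.eval η e₃ else Expr.eval η e₃
  | condR e₁ e₂ e₃ =>
      if Expr.eval η e₁ < 0 then Expr.eval η e₂ else Expr.eval η e₂ ⊔ Expr.eval η e₃
  | eqm e => eqNegInfVal (Expr.eval η e)

/-- The set of variables occurring in an expression. -/
def Expr.occ : Expr V → Set V
  | var X => {X}
  | const _ => ∅
  | scale _ e => Expr.occ e
  | add e₁ e₂ => Expr.occ e₁ ∪ Expr.occ e₂
  | emin e₁ e₂ => Expr.occ e₁ ∪ Expr.occ e₂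
  | emax e₁ e₂ => Expr.occ e₁ ∪ Expr.occ e₂
  | condL e₁ e₂ e₃ => Expr.occ e₁ ∪ Expr.occ e₂ ∪ Expr.occ e₃
  | condR e₁ e₂ e₃ => Expr.occ e₁ ∪ Expr.occ e₂ ∪ Expr.occ e₃
  | eqm e => Expr.occ e

/-- `e` contains no occurrence of the conditional operators. -/
def Expr.noCond : Expr V → Prop
  | var _ => True
  | const _ => True
  | scale _ e => Expr.noCond e
  | add e₁ e₂ => Expr.noCond e₁ ∧ Expr.noCond e₂
  | emin e₁ e₂ => Expr.noCond e₁ ∧ Expr.noCond e₂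
  | emax e₁ e₂ => Expr.noCond e₁ ∧ Expr.noCond e₂
  | condL _ _ _ => False
  | condR _ _ _ => False
  | eqm e => Expr.noCond e

/-- Syntactic substitution `e[X := g]`. -/
def Expr.subst [DecidableEq V] (X : V) (g : Expr V) : Expr V → Expr V
  | var Y => if Y = X then g else var Y
  | const d => const d
  | scale c e => scale c (Expr.subst X g e)
  | add e₁ e₂ => add (Expr.subst X g e₁) (Expr.subst X g e₂)
  | emin e₁ e₂ => emin (Expr.subst X g e₁) (Expr.subst X g e₂)
  | emax e₁ e₂ => emax (Expr.subst X g e₁) (Expr.subst X g e₂)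
  | condL e₁ e₂ e₃ => condL (Expr.subst X g e₁) (Expr.subst X g e₂) (Expr.subst X g e₃)
  | condR e₁ e₂ e₃ => condR (Expr.subst X g e₁) (Expr.subst X g e₂) (Expr.subst X g e₃)
  | eqm e => eqm (Expr.subst X g e)

/-- `(Σ_{(c,X) ∈ cs} c·X) + rest`. -/
def scaledSum (cs : List ({c : ℝ // 0 < c} × V)) (rest : Expr V) : Expr V :=
  cs.foldr (fun p acc => Expr.add (Expr.scale p.1 (Expr.var p.2)) acc) rest

/-- `(Σ_{X ∈ ms} eq-∞(X)) + rest`. -/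
def eqmSum (ms : List V) (rest : Expr V) : Expr V :=
  ms.foldr (fun X acc => Expr.add (Expr.eqm (Expr.var X)) acc) rest

/-- A term of the shape `(Σ_{X∈𝒳'} c^X·X) + (Σ_{X∈𝒳''} eq-∞(X)) + d`
with the variables in each of the two sums pairwise distinct. -/
def IsSimpleTerm (e : Expr V) : Prop :=
  ∃ (cs : List ({c : ℝ // 0 < c} × V)) (ms : List V) (d : EReal),
    (cs.map Prod.snd).Nodup ∧ ms.Nodup ∧ e = scaledSum cs (eqmSum ms (Expr.const d))

/-- Finite disjunction; the empty disjunction is `−∞`. -/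
def disjList : List (Expr V) → Expr V
  | [] => Expr.const ⊥
  | [e] => e
  | e :: es => Expr.emax e (disjList es)

/-- Finite conjunction; the empty conjunction is `∞`. -/
def conjList : List (Expr V) → Expr V
  | [] => Expr.const ⊤
  | [e] => e
  | e :: es => Expr.emin e (conjList es)

/-- Simple conjunctive normal form. -/
def IsSimpleCNF (e : Expr V) : Prop :=
  ∃ ls : List (List (Expr V)),
    (∀ l ∈ ls, ∀ t ∈ l, IsSimpleTerm t) ∧ e = conjList (ls.map disjList)

/-- Simple disjunctive normal form. -/
def IsSimpleDNF (e : Expr V) : Prop :=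
  ∃ ls : List (List (Expr V)),
    (∀ l ∈ ls, ∀ t ∈ l, IsSimpleTerm t) ∧ e = disjList (ls.map conjList)

/-- Conjunctive normal form. -/
inductive IsCNF : Expr V → Prop where
  | simple {e : Expr V} : IsSimpleCNF e → IsCNF e
  | condL {e₁ e₂ e₃ : Expr V} :
      IsSimpleCNF e₁ → IsCNF e₂ → IsCNF e₃ → IsCNF (Expr.condL e₁ e₂ e₃)
  | condR {e₁ e₂ e₃ : Expr V} :
      IsSimpleCNF e₁ → IsCNF e₂ → IsCNF e₃ → IsCNF (Expr.condR e₁ e₂ e₃)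

/-- Disjunctive normal form. -/
inductive IsDNF : Expr V → Prop where
  | simple {e : Expr V} : IsSimpleDNF e → IsDNF e
  | condL {e₁ e₂ e₃ : Expr V} :
      IsSimpleDNF e₁ → IsDNF e₂ → IsDNF e₃ → IsDNF (Expr.condL e₁ e₂ e₃)
  | condR {e₁ e₂ e₃ : Expr V} :
      IsSimpleDNF e₁ → IsDNF e₂ → IsDNF e₃ → IsDNF (Expr.condR e₁ e₂ e₃)

/-- Fixed-point symbols. -/
inductive FP where
  | mu : FP
  | nu : FP

/-- A real equation system: a finite sequence of fixed-point equations `σ X = e`. -/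
abbrev RES (V : Type*) := List (FP × V × Expr V)

/-- The bound variables of a RES. -/
def bnd (E : RES V) : List V := E.map (fun p => p.2.1)

variable [DecidableEq V]

/-- The solution `[[ℰ]]η` of a real equation system. -/
def sol : RES V → (V → EReal) → V → EReal
  | [], η => η
  | (FP.mu, X, e) :: E, η =>
      sol E (Function.update η X
        (sInf {r : EReal | Expr.eval (sol E (Function.update η X r)) e ≤ r}))
  | (FP.nu, X, e) :: E, η =>
      sol E (Function.update η X
        (sSup {r : EReal | r ≤ Expr.eval (sol E (Function.update η X r)) e}))

/-- Equivalence of real equation systems. -/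
def REquiv (E E' : RES V) : Prop :=
  ∀ F : RES V, (∀ Y ∈ bnd F, Y ∉ bnd E ∧ Y ∉ bnd E') →
    ∀ η : V → EReal, sol (E ++ F) η = sol (E' ++ F) η


set_option linter.unusedSectionVars false

/-! ### Arithmetic of the extended reals -/

@[simp] lemma top_eadd (x : EReal) : eadd ⊤ x = ⊤ := by simp [eadd]

@[simp] lemma eadd_top (x : EReal) : eadd x ⊤ = ⊤ := by simp [eadd]

@[simp] lemma bot_eadd_coe (r : ℝ) : eadd ⊥ (r : EReal) = ⊥ := by simp [eadd]

@[simp] lemma coe_eadd_bot (r : ℝ) : eadd (r : EReal) ⊥ = ⊥ := by simp [eadd]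

@[simp] lemma bot_eadd_bot : eadd ⊥ ⊥ = ⊥ := by simp [eadd]

@[simp] lemma bot_eadd_zero : eadd ⊥ 0 = ⊥ := bot_eadd_coe 0

@[simp] lemma coe_eadd_coe (r s : ℝ) : eadd (r : EReal) (s : EReal) = ((r + s : ℝ) : EReal) := by
  simp [eadd]

@[simp] lemma eadd_zero (x : EReal) : eadd x 0 = x := by
  by_cases h : x = ⊤ <;> simp [eadd, h]

lemma eadd_comm (x y : EReal) : eadd x y = eadd y x := by
  simp only [eadd, add_comm x y, or_comm]

lemma eadd_assoc (x y z : EReal) : eadd (eadd x y) z = eadd x (eadd y z) := by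
  induction x using EReal.rec <;> induction y using EReal.rec <;> induction z using EReal.rec <;>
    simp [-EReal.coe_add, add_assoc]

lemma eadd_eadd_eadd_comm (x y z w : EReal) :
    eadd (eadd x y) (eadd z w) = eadd (eadd x z) (eadd y w) := by
  rw [eadd_assoc, eadd_assoc, ← eadd_assoc y, eadd_comm y z, eadd_assoc]

lemma eadd_le_eadd {x x' y y' : EReal} (hx : x ≤ x') (hy : y ≤ y') : eadd x y ≤ eadd x' y' := by
  unfold eadd
  split_ifs with h h'
  · exact le_rfl
  · exact absurd (h.imp (fun h => top_le_iff.1 (h ▸ hx)) fun h => top_le_iff.1 (h ▸ hy)) h'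
  · exact le_top
  · exact add_le_add hx hy

@[simp] lemma scale_top (c : {c : ℝ // 0 < c}) : (c.1 : EReal) * ⊤ = ⊤ :=
  EReal.coe_mul_top_of_pos c.2

@[simp] lemma scale_bot (c : {c : ℝ // 0 < c}) : (c.1 : EReal) * ⊥ = ⊥ :=
  EReal.coe_mul_bot_of_pos c.2

lemma scale_mono (c : {c : ℝ // 0 < c}) : Monotone fun x : EReal => (c.1 : EReal) * x :=
  fun _ _ h => mul_le_mul_of_nonneg_left h (EReal.coe_nonneg.2 c.2.le)

lemma scale_eadd (c : {c : ℝ // 0 < c}) (x y : EReal) :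
    (c.1 : EReal) * eadd x y = eadd (c.1 * x) (c.1 * y) := by
  induction x using EReal.rec <;> induction y using EReal.rec <;>
    simp [-EReal.coe_add, ← EReal.coe_mul, mul_add]

lemma eadd_scale (c d : {c : ℝ // 0 < c}) (x : EReal) :
    eadd (c.1 * x) (d.1 * x) = ((c + d : {c : ℝ // 0 < c}).1 : EReal) * x := by
  induction x using EReal.rec
  · simp only [scale_bot, bot_eadd_bot]
  · simp [-EReal.coe_add, ← EReal.coe_mul, add_mul]
  · simp only [scale_top, top_eadd]

@[simp] lemma eqNegInfVal_bot : eqNegInfVal ⊥ = ⊥ := by simp [eqNegInfVal]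

@[simp] lemma eqNegInfVal_top : eqNegInfVal ⊤ = ⊤ := by simp [eqNegInfVal]

@[simp] lemma eqNegInfVal_coe (r : ℝ) : eqNegInfVal r = ⊤ := by simp [eqNegInfVal]

lemma eqNegInfVal_mono : Monotone eqNegInfVal := by
  intro x y h
  unfold eqNegInfVal
  split_ifs with hx hy hy
  · exact le_rfl
  · exact bot_le
  · exact absurd (le_bot_iff.1 (hy ▸ h)) hx
  · exact le_rfl

lemma eqNegInfVal_idem (x : EReal) : eqNegInfVal (eqNegInfVal x) = eqNegInfVal x := by
  induction x using EReal.rec <;> simp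

lemma scale_eqNegInfVal (c : {c : ℝ // 0 < c}) (x : EReal) :
    (c.1 : EReal) * eqNegInfVal x = eqNegInfVal x := by
  induction x using EReal.rec <;> simp

lemma eadd_scale_eqNegInfVal (c : {c : ℝ // 0 < c}) (x : EReal) :
    eadd (c.1 * x) (eqNegInfVal x) = eqNegInfVal x := by
  induction x using EReal.rec <;> simp

lemma eadd_eqNegInfVal_self (x : EReal) :
    eadd (eqNegInfVal x) (eqNegInfVal x) = eqNegInfVal x := by
  induction x using EReal.rec <;> simp

lemma eqNegInfVal_scale (c : {c : ℝ // 0 < c}) (x : EReal) :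
    eqNegInfVal (c.1 * x) = eqNegInfVal x := by
  induction x using EReal.rec <;> simp [← EReal.coe_mul]

/-- `eq-∞` of a sum in terms of `eq-∞` and `eq∞` of the summands. -/
lemma eqNegInfVal_eadd (x y : EReal) : eqNegInfVal (eadd x y) =
    (eqNegInfVal x ⊔ eadd y ⊥) ⊓ (eqNegInfVal y ⊔ eadd x ⊥) := by
  induction x using EReal.rec <;> induction y using EReal.rec <;>
    simp [-EReal.coe_add]

/-! ### Least and greatest fixed points of monotone functions -/

/-- The least pre-fixed point. -/
def leastFP (h : EReal → EReal) : EReal := sInf {x | h x ≤ x}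

/-- The greatest post-fixed point. -/
def greatestFP (h : EReal → EReal) : EReal := sSup {x | x ≤ h x}

section FixedPoints

variable {f g h t : EReal → EReal} {x : EReal}

lemma leastFP_le (hx : h x ≤ x) : leastFP h ≤ x := sInf_le hx

lemma le_greatestFP (hx : x ≤ h x) : x ≤ greatestFP h := le_sSup hx

lemma map_leastFP_le (hm : Monotone h) : h (leastFP h) ≤ leastFP h :=
  le_sInf fun _ hx => (hm (leastFP_le hx)).trans hx

lemma greatestFP_le_map (hm : Monotone h) : greatestFP h ≤ h (greatestFP h) :=
  sSup_le fun _ hx => le_trans hx (hm (le_greatestFP hx))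

lemma leastFP_mono (hfg : f ≤ g) : leastFP f ≤ leastFP g :=
  le_sInf fun x hx => leastFP_le ((hfg x).trans hx)

lemma greatestFP_mono (hfg : f ≤ g) : greatestFP f ≤ greatestFP g :=
  sSup_le fun x hx => le_greatestFP (le_trans hx (hfg x))

lemma leastFP_inf (hf : Monotone f) (hg : Monotone g) :
    leastFP (f ⊓ g) = leastFP f ⊓ leastFP g := by
  refine le_antisymm (le_inf (leastFP_mono inf_le_left) (leastFP_mono inf_le_right)) ?_
  rcases inf_le_iff.1 (map_leastFP_le (h := f ⊓ g) (hf.inf hg)) with h | h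
  · exact inf_le_of_left_le (leastFP_le h)
  · exact inf_le_of_right_le (leastFP_le h)

lemma greatestFP_sup (hf : Monotone f) (hg : Monotone g) :
    greatestFP (f ⊔ g) = greatestFP f ⊔ greatestFP g := by
  refine le_antisymm ?_ (sup_le (greatestFP_mono le_sup_left) (greatestFP_mono le_sup_right))
  rcases le_sup_iff.1 (greatestFP_le_map (h := f ⊔ g) (hf.sup hg)) with h | h
  · exact le_sup_of_le_left (le_greatestFP h)
  · exact le_sup_of_le_right (le_greatestFP h)

lemma between_of_cases {p : EReal → Prop} (hfg : f ≤ g) (hf : ∀ x, p x → h x = f x)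
    (hg : ∀ x, ¬ p x → h x = g x) : f ≤ h ∧ h ≤ g := by
  constructor <;> intro x <;> by_cases hx : p x
  · rw [hf x hx]
  · rw [hg x hx]; exact hfg x
  · rw [hf x hx]; exact hfg x
  · rw [hg x hx]

/-- If `h` is `f` on a lower set `p` and `g ≥ f` elsewhere, its least fixed point is decided by
whether the least fixed point of `f` lies in `p`. -/
lemma leastFP_cases {p : EReal → Prop} (hp : ∀ x y, x ≤ y → p y → p x) (hfg : f ≤ g)
    (hm : Monotone f) (hmh : Monotone h) (hf : ∀ x, p x → h x = f x)
    (hg : ∀ x, ¬ p x → h x = g x) :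
    (p (leastFP f) → leastFP h = leastFP f) ∧ (¬ p (leastFP f) → leastFP h = leastFP g) := by
  obtain ⟨h₁, h₂⟩ := between_of_cases hfg hf hg
  refine ⟨fun hs => ?_, fun hs => ?_⟩
  · exact le_antisymm (leastFP_le ((hf _ hs).trans_le (map_leastFP_le hm))) (leastFP_mono h₁)
  · refine le_antisymm (leastFP_mono h₂) (leastFP_le ?_)
    rw [← hg _ fun hu => hs (hp _ _ (leastFP_mono h₁) hu)]
    exact map_leastFP_le hmh

/-- If `h` is `f` on a lower set `p` and `g ≥ f` elsewhere, its greatest fixed point is decided by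
whether the greatest fixed point of `g` lies in `p`. -/
lemma greatestFP_cases {p : EReal → Prop} (hp : ∀ x y, x ≤ y → p y → p x) (hfg : f ≤ g)
    (hm : Monotone g) (hmh : Monotone h) (hf : ∀ x, p x → h x = f x)
    (hg : ∀ x, ¬ p x → h x = g x) :
    (p (greatestFP g) → greatestFP h = greatestFP f) ∧
      (¬ p (greatestFP g) → greatestFP h = greatestFP g) := by
  obtain ⟨h₁, h₂⟩ := between_of_cases hfg hf hg
  refine ⟨fun hs => ?_, fun hs => ?_⟩
  · refine le_antisymm (le_greatestFP ?_) (greatestFP_mono h₁)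
    rw [← hf _ (hp _ _ (greatestFP_mono h₂) hs)]
    exact greatestFP_le_map hmh
  · exact le_antisymm (greatestFP_mono h₂)
      (le_greatestFP ((greatestFP_le_map hm).trans_eq (hg _ hs).symm))

lemma leastFP_sup_eq (hg : Monotone g) (ht : t (leastFP g) ≤ leastFP g) :
    leastFP (t ⊔ g) = leastFP g :=
  le_antisymm (leastFP_le (sup_le ht (map_leastFP_le hg))) (leastFP_mono le_sup_right)

lemma leastFP_sup_eq_top (ht : ∀ x, leastFP g ≤ x → t x ≤ x → x = ⊤) : leastFP (t ⊔ g) = ⊤ :=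
  sInf_eq_top.2 fun x hx =>
    ht x (leastFP_le (le_sup_right.trans hx)) (le_sup_left.trans hx)

lemma greatestFP_inf_eq (hg : Monotone g) (ht : greatestFP g ≤ t (greatestFP g)) :
    greatestFP (t ⊓ g) = greatestFP g :=
  le_antisymm (greatestFP_mono inf_le_right) (le_greatestFP (le_inf ht (greatestFP_le_map hg)))

lemma greatestFP_inf_eq_bot (ht : ∀ x, x ≤ greatestFP g → x ≤ t x → x = ⊥) :
    greatestFP (t ⊓ g) = ⊥ :=
  sSup_eq_bot.2 fun x hx =>
    ht x (le_greatestFP (le_trans hx inf_le_right)) (le_trans hx inf_le_left)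

/-- Least fixed points along the diagonal can be computed one argument at a time. -/
lemma leastFP_diag {H : EReal → EReal → EReal} (h₁ : ∀ y, Monotone fun x => H x y)
    (h₂ : ∀ x, Monotone (H x)) :
    leastFP (fun x => H x x) = leastFP fun x => leastFP (H x) := by
  refine le_antisymm (le_sInf fun x hx => ?_) (le_sInf fun x hx => ?_)
  · have hx' : leastFP (H x) ≤ x := hx
    exact (leastFP_le (h := fun x => H x x)
      ((h₁ _ hx').trans (map_leastFP_le (h₂ x)))).trans hx'
  · exact leastFP_le (leastFP_le (h := H x) hx)

/-- Greatest fixed points along the diagonal can be computed one argument at a time. -/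
lemma greatestFP_diag {H : EReal → EReal → EReal} (h₁ : ∀ y, Monotone fun x => H x y)
    (h₂ : ∀ x, Monotone (H x)) :
    greatestFP (fun x => H x x) = greatestFP fun x => greatestFP (H x) := by
  refine le_antisymm (sSup_le fun x hx => ?_) (sSup_le fun x hx => ?_)
  · exact le_greatestFP (le_greatestFP (h := H x) hx)
  · have hx' : x ≤ greatestFP (H x) := hx
    exact hx'.trans (le_greatestFP ((greatestFP_le_map (h₂ x)).trans (h₁ _ hx')))

lemma leastFP_congr (hfg : ∀ x, f x ≤ x ↔ g x ≤ x) : leastFP f = leastFP g := by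
  simp only [leastFP, hfg]

lemma greatestFP_congr (hfg : ∀ x, x ≤ f x ↔ x ≤ g x) : greatestFP f = greatestFP g := by
  simp only [greatestFP, hfg]

end FixedPoints

/-! ### Solving a single affine constraint -/

section Affine

variable {c d : {c : ℝ // 0 < c}} {r s x : EReal}

lemma eadd_scale_le_of_test (hc : c.1 - d.1 = 1) (hq : eadd (d.1 * s) r ≤ 0) :
    eadd (c.1 * s) r ≤ s := by
  induction s using EReal.rec <;> induction r using EReal.rec <;>
    simp_all [-EReal.coe_add, ← EReal.coe_mul]
  rename_i a b
  norm_cast at *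
  linear_combination hq + a * hc

lemma eq_top_of_test (hc : c.1 - d.1 = 1) (hq : ¬ eadd (d.1 * s) r ≤ 0) (hx : s ≤ x)
    (ht : eadd (c.1 * x) r ≤ x) : x = ⊤ := by
  by_contra hx'
  refine hq ((eadd_le_eadd (scale_mono d hx) le_rfl).trans ?_)
  clear hq hx
  induction x using EReal.rec <;> induction r using EReal.rec <;>
    simp_all [-EReal.coe_add, ← EReal.coe_mul]
  rename_i a b
  norm_cast at *
  linear_combination ht - a * hc

lemma le_eadd_scale_of_test (hc : c.1 - d.1 = 1) (hq : ¬ eadd (d.1 * s) r < 0) :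
    s ≤ eadd (c.1 * s) r := by
  induction s using EReal.rec <;> induction r using EReal.rec <;>
    simp_all [-EReal.coe_add, ← EReal.coe_mul]
  rename_i a b
  norm_cast at *
  linear_combination hq - a * hc

lemma eq_bot_of_test (hc : c.1 - d.1 = 1) (hq : eadd (d.1 * s) r < 0) (hx : x ≤ s)
    (ht : x ≤ eadd (c.1 * x) r) : x = ⊥ := by
  by_contra hx'
  refine ((eadd_le_eadd (scale_mono d hx) le_rfl).trans_lt hq).not_ge ?_
  clear hq hx
  induction x using EReal.rec <;> induction r using EReal.rec <;>
    simp_all [-EReal.coe_add, ← EReal.coe_mul]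
  rename_i a b
  norm_cast at *
  linear_combination ht + a * hc

lemma eadd_le_of_test (hq : eadd r (eqNegInfVal s ⊓ 0) ≤ 0) : eadd s r ≤ s := by
  induction s using EReal.rec <;> induction r using EReal.rec <;> simp_all [-EReal.coe_add]

lemma eq_top_of_unit_test (hq : ¬ eadd r (eqNegInfVal s ⊓ 0) ≤ 0) (hx : s ≤ x)
    (ht : eadd x r ≤ x) : x = ⊤ := by
  induction s using EReal.rec <;> induction r using EReal.rec <;>
    induction x using EReal.rec <;> simp_all [-EReal.coe_add]
  norm_cast at *
  linarith

lemma le_eadd_of_test (hq : ¬ eadd r (eadd s ⊥ ⊔ 0) < 0) : s ≤ eadd s r := by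
  induction s using EReal.rec <;> induction r using EReal.rec <;> simp_all [-EReal.coe_add]

lemma eq_bot_of_unit_test (hq : eadd r (eadd s ⊥ ⊔ 0) < 0) (hx : x ≤ s)
    (ht : x ≤ eadd x r) : x = ⊥ := by
  induction s using EReal.rec <;> induction r using EReal.rec <;>
    induction x using EReal.rec <;> simp_all [-EReal.coe_add]
  norm_cast at *
  linarith

lemma eadd_eqNegInfVal_le_of_test (hq : eadd (eqNegInfVal s) r ≤ 0) :
    eadd (eqNegInfVal s) r ≤ s := by
  induction s using EReal.rec <;> induction r using EReal.rec <;> simp_all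

lemma eq_top_of_eqNegInfVal_test (hq : ¬ eadd (eqNegInfVal s) r ≤ 0) (hx : s ≤ x)
    (ht : eadd (eqNegInfVal x) r ≤ x) : x = ⊤ := by
  induction s using EReal.rec <;> induction r using EReal.rec <;>
    induction x using EReal.rec <;> simp_all

lemma le_eadd_eqNegInfVal : x ≤ eadd (eqNegInfVal x) r := by
  induction x using EReal.rec <;> simp

lemma eadd_scale_le_iff (hc : d.1 * (1 - c.1) = 1) (hx : x ≠ ⊥) :
    eadd (c.1 * x) r ≤ x ↔ d.1 * r ≤ x := by
  induction x using EReal.rec <;> induction r using EReal.rec <;>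
    simp_all [-EReal.coe_add, ← EReal.coe_mul]
  rename_i x r
  have hd := d.2
  have e : d.1 * x - d.1 * (c.1 * x) = x := by linear_combination x * hc
  rw [← mul_le_mul_iff_right₀ hd, mul_add]
  constructor <;> intro h <;> linarith

lemma le_eadd_scale_iff (hc : d.1 * (1 - c.1) = 1) (hx : x ≠ ⊤) :
    x ≤ eadd (c.1 * x) r ↔ x ≤ d.1 * r := by
  induction x using EReal.rec <;> induction r using EReal.rec <;>
    simp_all [-EReal.coe_add, ← EReal.coe_mul]
  rename_i x r
  have hd := d.2
  have e : d.1 * x - d.1 * (c.1 * x) = x := by linear_combination x * hc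
  rw [← mul_le_mul_iff_right₀ hd, mul_add]
  constructor <;> intro h <;> linarith

lemma leastFP_sup_scale {k : EReal → EReal} (hk : Monotone k) (hc : d.1 * (1 - c.1) = 1) :
    leastFP ((fun x => eadd (c.1 * x) r) ⊔ k) =
      leastFP fun x => eadd (d.1 * r) (eqNegInfVal (leastFP k) ⊓ 0) ⊔ k x := by
  by_cases hs : leastFP k = ⊥
  · by_cases hr : r = ⊤
    · subst hr
      simp [leastFP]
    · have hr' : eadd (d.1 * r) ⊥ = ⊥ ∧ eadd ⊥ r = ⊥ := by
        induction r using EReal.rec <;> simp_all [← EReal.coe_mul]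
      rw [leastFP_sup_eq hk (by simp [hs, hr'])]
      simp [hs, hr']
  · have : eqNegInfVal (leastFP k) ⊓ 0 = 0 := by simp [eqNegInfVal, hs]
    rw [this, eadd_zero]
    refine leastFP_congr fun x => ?_
    simp only [Pi.sup_apply, sup_le_iff]
    exact and_congr_left fun hx =>
      eadd_scale_le_iff hc (ne_bot_of_le_ne_bot hs (leastFP_le hx))

lemma greatestFP_inf_scale {k : EReal → EReal} (hk : Monotone k) (hc : d.1 * (1 - c.1) = 1) :
    greatestFP ((fun x => eadd (c.1 * x) r) ⊓ k) =
      greatestFP fun x => (d.1 * r ⊔ eadd (greatestFP k) ⊥) ⊓ k x := by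
  by_cases hs : greatestFP k = ⊤
  · rw [greatestFP_inf_eq hk (by simp [hs])]
    simp [hs]
  · have : eadd (greatestFP k) ⊥ = ⊥ := by
      generalize greatestFP k = s at hs
      induction s using EReal.rec <;> simp_all
    rw [this, sup_bot_eq]
    refine greatestFP_congr fun x => ?_
    simp only [Pi.inf_apply, le_inf_iff]
    exact and_congr_left fun hx =>
      le_eadd_scale_iff hc (ne_top_of_le_ne_top hs (le_greatestFP hx))

end Affine

/-! ### Semantics of expressions -/

lemma eval_mono (e : Expr V) : Monotone fun η : V → EReal => e.eval η := by
  intro η η' h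
  induction e with
  | var Y => exact h Y
  | const d => exact le_rfl
  | scale c e ih => exact scale_mono c ih
  | add e₁ e₂ ih₁ ih₂ => exact eadd_le_eadd ih₁ ih₂
  | emin e₁ e₂ ih₁ ih₂ => exact inf_le_inf ih₁ ih₂
  | emax e₁ e₂ ih₁ ih₂ => exact sup_le_sup ih₁ ih₂
  | condL e₁ e₂ e₃ ih₁ ih₂ ih₃ =>
    simp only [Expr.eval] at *
    split_ifs with h₁ h₂ h₂
    · exact inf_le_inf ih₂ ih₃
    · exact inf_le_of_right_le ih₃
    · exact absurd (ih₁.trans h₂) h₁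
    · exact ih₃
  | condR e₁ e₂ e₃ ih₁ ih₂ ih₃ =>
    simp only [Expr.eval] at *
    split_ifs with h₁ h₂ h₂
    · exact ih₂
    · exact le_sup_of_le_left ih₂
    · exact absurd (ih₁.trans_lt h₂) h₁
    · exact sup_le_sup ih₂ ih₃
  | eqm e ih => exact eqNegInfVal_mono ih

lemma eval_update_mono (e : Expr V) (X : V) (η : V → EReal) :
    Monotone fun x => e.eval (Function.update η X x) :=
  fun _ _ h => eval_mono e (Function.update_mono h)

lemma eval_update_of_notMem_occ {X : V} {e : Expr V} (h : X ∉ e.occ) (η : V → EReal)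
    (x : EReal) : e.eval (Function.update η X x) = e.eval η := by
  induction e with
  | var Y => exact Function.update_of_ne (fun h' => h h'.symm) _ _
  | const d => rfl
  | _ => simp_all [Expr.eval, Expr.occ]

lemma eval_subst (X : V) (g e : Expr V) (η : V → EReal) :
    (Expr.subst X g e).eval η = e.eval (Function.update η X (g.eval η)) := by
  induction e with
  | var Y =>
    by_cases h : Y = X
    · subst h; simp [Expr.subst, Expr.eval]
    · simp [Expr.subst, Expr.eval, h]
  | const d => rfl
  | _ => simp_all [Expr.eval, Expr.subst]

lemma notMem_occ_subst {X : V} {g : Expr V} (hg : X ∉ g.occ) (e : Expr V) :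
    X ∉ (Expr.subst X g e).occ := by
  induction e with
  | var Y =>
    by_cases h : Y = X
    · simpa [Expr.subst, h] using hg
    · simpa [Expr.subst, h, Expr.occ] using Ne.symm h
  | const d => exact id
  | _ => simp_all [Expr.occ, Expr.subst]

/-- `v` is the semantics of an expression in which `X` does not occur. -/
def IsFree (X : V) (v : (V → EReal) → EReal) : Prop :=
  ∃ e : Expr V, X ∉ e.occ ∧ ∀ η, e.eval η = v η

namespace IsFree

variable {X : V} {u v w : (V → EReal) → EReal}

lemma const (d : EReal) : IsFree X fun _ => d := ⟨.const d, id, fun _ => rfl⟩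

lemma var {Y : V} (h : X ≠ Y) : IsFree X fun η => η Y := ⟨.var Y, h, fun _ => rfl⟩

lemma scale (c : {c : ℝ // 0 < c}) (hu : IsFree X u) : IsFree X fun η => c.1 * u η :=
  let ⟨e, he, h⟩ := hu
  ⟨.scale c e, he, fun η => by simp [Expr.eval, h]⟩

lemma eqm (hu : IsFree X u) : IsFree X fun η => eqNegInfVal (u η) :=
  let ⟨e, he, h⟩ := hu
  ⟨.eqm e, he, fun η => by simp [Expr.eval, h]⟩

lemma add (hu : IsFree X u) (hv : IsFree X v) : IsFree X fun η => eadd (u η) (v η) :=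
  let ⟨e, he, h⟩ := hu
  let ⟨e', he', h'⟩ := hv
  ⟨.add e e', by simp [Expr.occ, he, he'], fun η => by simp [Expr.eval, h, h']⟩

lemma inf (hu : IsFree X u) (hv : IsFree X v) : IsFree X fun η => u η ⊓ v η :=
  let ⟨e, he, h⟩ := hu
  let ⟨e', he', h'⟩ := hv
  ⟨.emin e e', by simp [Expr.occ, he, he'], fun η => by simp [Expr.eval, h, h']⟩

lemma sup (hu : IsFree X u) (hv : IsFree X v) : IsFree X fun η => u η ⊔ v η :=
  let ⟨e, he, h⟩ := hu
  let ⟨e', he', h'⟩ := hv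
  ⟨.emax e e', by simp [Expr.occ, he, he'], fun η => by simp [Expr.eval, h, h']⟩

lemma eval_update (e : Expr V) (hu : IsFree X u) :
    IsFree X fun η => e.eval (Function.update η X (u η)) :=
  let ⟨g, hg, h⟩ := hu
  ⟨Expr.subst X g e, notMem_occ_subst hg e, fun η => by rw [eval_subst, h]⟩

lemma of_le_zero {q : (V → EReal) → EReal} (hq : IsFree X q) (hu : IsFree X u)
    (hv : IsFree X v) (huv : u ≤ v) (hwu : ∀ η, q η ≤ 0 → w η = u η)
    (hwv : ∀ η, ¬ q η ≤ 0 → w η = v η) : IsFree X w := by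
  obtain ⟨a, ha, ha'⟩ := hq
  obtain ⟨b, hb, hb'⟩ := hu
  obtain ⟨c, hc, hc'⟩ := hv
  refine ⟨.condL a b c, by simp [Expr.occ, ha, hb, hc], fun η => ?_⟩
  simp only [Expr.eval, ha', hb', hc']
  split_ifs with h
  · rw [hwu η h, inf_eq_left.2 (huv η)]
  · rw [hwv η h]

lemma of_lt_zero {q : (V → EReal) → EReal} (hq : IsFree X q) (hu : IsFree X u)
    (hv : IsFree X v) (huv : u ≤ v) (hwu : ∀ η, q η < 0 → w η = u η)
    (hwv : ∀ η, ¬ q η < 0 → w η = v η) : IsFree X w := by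
  obtain ⟨a, ha, ha'⟩ := hq
  obtain ⟨b, hb, hb'⟩ := hu
  obtain ⟨c, hc, hc'⟩ := hv
  refine ⟨.condR a b c, by simp [Expr.occ, ha, hb, hc], fun η => ?_⟩
  simp only [Expr.eval, ha', hb', hc']
  split_ifs with h
  · rw [hwu η h]
  · rw [hwv η h, sup_eq_right.2 (huv η)]

end IsFree

/-! ### Solving finite combinations of affine functions -/

/-- Functions of one distinguished unknown, parametrised by a valuation. -/
abbrev Family (V : Type*) := (V → EReal) → EReal → EReal

/-- The affine families in the unknown `X`, with coefficients in which `X` does not occur. -/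
inductive IsAtom (X : V) : Family V → Prop
  | const {r : (V → EReal) → EReal} : IsFree X r → IsAtom X fun η _ => r η
  | scale (c : {c : ℝ // 0 < c}) {r : (V → EReal) → EReal} : IsFree X r →
      IsAtom X fun η x => eadd (c.1 * x) (r η)
  | eqm {r : (V → EReal) → EReal} : IsFree X r →
      IsAtom X fun η x => eadd (eqNegInfVal x) (r η)

lemma IsAtom.monotone {X : V} {t : Family V} (ht : IsAtom X t) (η : V → EReal) :
    Monotone (t η) := by
  cases ht with
  | const _ => exact monotone_const
  | scale c _ => exact fun _ _ h => eadd_le_eadd (scale_mono c h) le_rfl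
  | eqm _ => exact fun _ _ h => eadd_le_eadd (eqNegInfVal_mono h) le_rfl

/-- For every coefficient `a`, the least fixed point of `a ∨ g` is expressible without `X`. -/
structure IsLeastSolvable (X : V) (g : Family V) : Prop where
  monotone : ∀ η, Monotone (g η)
  isFree : ∀ a : (V → EReal) → EReal, IsFree X a →
    IsFree X fun η => leastFP ((fun _ => a η) ⊔ g η)

/-- For every coefficient `a`, the greatest fixed point of `a ∧ g` is expressible without `X`. -/
structure IsGreatestSolvable (X : V) (g : Family V) : Prop where
  monotone : ∀ η, Monotone (g η)
  isFree : ∀ a : (V → EReal) → EReal, IsFree X a →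
    IsFree X fun η => greatestFP ((fun _ => a η) ⊓ g η)

section Solvable

variable {X : V} {t k : Family V}

lemma IsLeastSolvable.sup_of_test (hk : IsLeastSolvable X k) (ht : ∀ η, Monotone (t η))
    (H : ∀ s, IsFree X s → ∃ q, IsFree X q ∧ ∀ η, (q η ≤ 0 → t η (s η) ≤ s η) ∧
      (¬ q η ≤ 0 → ∀ x, s η ≤ x → t η x ≤ x → x = ⊤)) : IsLeastSolvable X (t ⊔ k) := by
  refine ⟨fun η => (ht η).sup (hk.monotone η), fun a ha => ?_⟩
  obtain ⟨q, hq, hq'⟩ := H _ (hk.isFree a ha)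
  have hm : ∀ η, Monotone ((fun _ => a η) ⊔ k η) := fun η => monotone_const.sup (hk.monotone η)
  simp only [Pi.sup_apply, sup_left_comm _ (t _)]
  exact hq.of_le_zero (hk.isFree a ha) (IsFree.const ⊤) (fun _ => le_top)
    (fun η h => leastFP_sup_eq (hm η) ((hq' η).1 h))
    (fun η h => leastFP_sup_eq_top ((hq' η).2 h))

lemma IsGreatestSolvable.inf_of_test (hk : IsGreatestSolvable X k) (ht : ∀ η, Monotone (t η))
    (H : ∀ s, IsFree X s → ∃ q, IsFree X q ∧ ∀ η, (¬ q η < 0 → s η ≤ t η (s η)) ∧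
      (q η < 0 → ∀ x, x ≤ s η → x ≤ t η x → x = ⊥)) : IsGreatestSolvable X (t ⊓ k) := by
  refine ⟨fun η => (ht η).inf (hk.monotone η), fun a ha => ?_⟩
  obtain ⟨q, hq, hq'⟩ := H _ (hk.isFree a ha)
  have hm : ∀ η, Monotone ((fun _ => a η) ⊓ k η) := fun η => monotone_const.inf (hk.monotone η)
  simp only [Pi.inf_apply, inf_left_comm _ (t _)]
  exact hq.of_lt_zero (IsFree.const ⊥) (hk.isFree a ha) (fun _ => bot_le)
    (fun η h => greatestFP_inf_eq_bot ((hq' η).2 h))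
    (fun η h => greatestFP_inf_eq (hm η) ((hq' η).1 h))

lemma IsAtom.sup_isLeastSolvable (ht : IsAtom X t) (hk : IsLeastSolvable X k) :
    IsLeastSolvable X (t ⊔ k) := by
  have htm := ht.monotone
  cases ht with
  | const hr =>
    refine ⟨fun η => (htm η).sup (hk.monotone η), fun a ha => ?_⟩
    simp only [Pi.sup_apply, ← sup_assoc]
    exact hk.isFree _ (ha.sup hr)
  | @scale c r hr =>
    rcases lt_trichotomy c.1 1 with hc | hc | hc
    · have hc' : 0 < 1 - c.1 := sub_pos.2 hc
      let d : {c : ℝ // 0 < c} := ⟨(1 - c.1)⁻¹, inv_pos.2 hc'⟩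
      have hd : d.1 * (1 - c.1) = 1 := inv_mul_cancel₀ hc'.ne'
      refine ⟨fun η => (htm η).sup (hk.monotone η), fun a ha => ?_⟩
      have hm : ∀ η, Monotone ((fun _ => a η) ⊔ k η) :=
        fun η => monotone_const.sup (hk.monotone η)
      have := hk.isFree _ (((hr.scale d).add
        ((hk.isFree a ha).eqm.inf (IsFree.const 0))).sup ha)
      convert this using 2 with η
      rw [Pi.sup_apply, sup_left_comm, leastFP_sup_scale (hm η) hd]
      simp only [Pi.sup_def, sup_assoc]
    · refine hk.sup_of_test htm fun s hs => ⟨_, hr.add (hs.eqm.inf (IsFree.const 0)), fun η => ?_⟩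
      simp only [hc, EReal.coe_one, one_mul]
      exact ⟨eadd_le_of_test, fun h _ => eq_top_of_unit_test h⟩
    · let d : {c : ℝ // 0 < c} := ⟨c.1 - 1, sub_pos.2 hc⟩
      have hd : c.1 - d.1 = 1 := sub_sub_cancel _ _
      exact hk.sup_of_test htm fun s hs => ⟨_, (hs.scale d).add hr, fun η =>
        ⟨eadd_scale_le_of_test hd, fun h _ => eq_top_of_test hd h⟩⟩
  | eqm hr =>
    exact hk.sup_of_test htm fun s hs => ⟨_, hs.eqm.add hr, fun η =>
      ⟨eadd_eqNegInfVal_le_of_test, fun h _ => eq_top_of_eqNegInfVal_test h⟩⟩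

lemma IsAtom.inf_isGreatestSolvable (ht : IsAtom X t) (hk : IsGreatestSolvable X k) :
    IsGreatestSolvable X (t ⊓ k) := by
  have htm := ht.monotone
  cases ht with
  | const hr =>
    refine ⟨fun η => (htm η).inf (hk.monotone η), fun a ha => ?_⟩
    simp only [Pi.inf_apply, ← inf_assoc]
    exact hk.isFree _ (ha.inf hr)
  | @scale c r hr =>
    rcases lt_trichotomy c.1 1 with hc | hc | hc
    · have hc' : 0 < 1 - c.1 := sub_pos.2 hc
      let d : {c : ℝ // 0 < c} := ⟨(1 - c.1)⁻¹, inv_pos.2 hc'⟩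
      have hd : d.1 * (1 - c.1) = 1 := inv_mul_cancel₀ hc'.ne'
      refine ⟨fun η => (htm η).inf (hk.monotone η), fun a ha => ?_⟩
      have hm : ∀ η, Monotone ((fun _ => a η) ⊓ k η) :=
        fun η => monotone_const.inf (hk.monotone η)
      have := hk.isFree _ (((hr.scale d).sup
        ((hk.isFree a ha).add (IsFree.const ⊥))).inf ha)
      convert this using 2 with η
      rw [Pi.inf_apply, inf_left_comm, greatestFP_inf_scale (hm η) hd]
      simp only [Pi.inf_def, inf_assoc]
    · refine hk.inf_of_test htm fun s hs =>
        ⟨_, hr.add ((hs.add (IsFree.const ⊥)).sup (IsFree.const 0)), fun η => ?_⟩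
      simp only [hc, EReal.coe_one, one_mul]
      exact ⟨le_eadd_of_test, fun h _ => eq_bot_of_unit_test h⟩
    · let d : {c : ℝ // 0 < c} := ⟨c.1 - 1, sub_pos.2 hc⟩
      have hd : c.1 - d.1 = 1 := sub_sub_cancel _ _
      exact hk.inf_of_test htm fun s hs => ⟨_, (hs.scale d).add hr, fun η =>
        ⟨le_eadd_scale_of_test hd, fun h _ => eq_bot_of_test hd h⟩⟩
  | eqm hr =>
    exact hk.inf_of_test htm fun s hs => ⟨_, IsFree.const 0, fun η =>
      ⟨fun _ => le_eadd_eqNegInfVal, fun h => absurd h (lt_irrefl 0)⟩⟩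

/-- Monotone families whose least and greatest fixed points are expressible without `X`. -/
structure IsSolvable (X : V) (g : Family V) : Prop where
  monotone : ∀ η, Monotone (g η)
  least : IsFree X fun η => leastFP (g η)
  greatest : IsFree X fun η => greatestFP (g η)

lemma isLeastSolvable_of_mem_supClosure {g : Family V} (hg : g ∈ supClosure {t | IsAtom X t}) :
    IsLeastSolvable X g := by
  have key : supClosure {t | IsAtom X t} ⊆
      {g | ∀ k, IsLeastSolvable X k → IsLeastSolvable X (g ⊔ k)} := by
    refine supClosure_min (fun t ht k hk => IsAtom.sup_isLeastSolvable ht hk) ?_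
    intro g hg g' hg' k hk
    rw [sup_assoc]
    exact hg _ (hg' _ hk)
  have hbot : IsLeastSolvable X (⊥ : Family V) :=
    ⟨fun _ => monotone_const, fun a ha => by
      convert ha using 2 with η
      rw [Pi.bot_apply, sup_bot_eq]
      exact le_antisymm (leastFP_le le_rfl) (le_sInf fun _ h => h)⟩
  simpa using key hg ⊥ hbot

lemma isGreatestSolvable_of_mem_infClosure {g : Family V}
    (hg : g ∈ infClosure {t | IsAtom X t}) : IsGreatestSolvable X g := by
  have key : infClosure {t | IsAtom X t} ⊆
      {g | ∀ k, IsGreatestSolvable X k → IsGreatestSolvable X (g ⊓ k)} := by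
    refine infClosure_min (fun t ht k hk => IsAtom.inf_isGreatestSolvable ht hk) ?_
    intro g hg g' hg' k hk
    rw [inf_assoc]
    exact hg _ (hg' _ hk)
  have htop : IsGreatestSolvable X (⊤ : Family V) :=
    ⟨fun _ => monotone_const, fun a ha => by
      convert ha using 2 with η
      rw [Pi.top_apply, inf_top_eq]
      exact le_antisymm (sSup_le fun _ h => h) (le_greatestFP le_rfl)⟩
  simpa using key hg ⊤ htop

lemma isSolvable_of_mem_latticeClosure {g : Family V}
    (hg : g ∈ latticeClosure {t | IsAtom X t}) : IsSolvable X g := by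
  have hμ : latticeClosure {t | IsAtom X t} ⊆
      {g | (∀ η, Monotone (g η)) ∧ IsFree X fun η => leastFP (g η)} := by
    rw [← infClosure_supClosure]
    refine infClosure_min (fun g hg => ?_) fun g hg g' hg' => ?_
    · have h := isLeastSolvable_of_mem_supClosure hg
      refine ⟨h.monotone, ?_⟩
      convert h.isFree _ (IsFree.const ⊥) using 3 with η
      exact (bot_sup_eq (g η)).symm
    · refine ⟨fun η => (hg.1 η).inf (hg'.1 η), ?_⟩
      simpa only [Pi.inf_apply, leastFP_inf (hg.1 _) (hg'.1 _)] using hg.2.inf hg'.2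
  have hν : latticeClosure {t | IsAtom X t} ⊆
      {g | (∀ η, Monotone (g η)) ∧ IsFree X fun η => greatestFP (g η)} := by
    rw [← supClosure_infClosure]
    refine supClosure_min (fun g hg => ?_) fun g hg g' hg' => ?_
    · have h := isGreatestSolvable_of_mem_infClosure hg
      refine ⟨h.monotone, ?_⟩
      convert h.isFree _ (IsFree.const ⊤) using 3 with η
      exact (top_inf_eq (g η)).symm
    · refine ⟨fun η => (hg.1 η).sup (hg'.1 η), ?_⟩
      simpa only [Pi.sup_apply, greatestFP_sup (hg.1 _) (hg'.1 _)] using hg.2.sup hg'.2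
  exact ⟨(hμ hg).1, (hμ hg).2, (hν hg).2⟩

end Solvable

/-! ### Solving conditional expressions -/

/-- A decision on the value of the unknown that can be evaluated at any value expressible
without `X`. -/
structure IsGuard (X : V) (p : (V → EReal) → EReal → Prop) : Prop where
  antitone : ∀ η x y, x ≤ y → p η y → p η x
  isFree : ∀ {s u v w : (V → EReal) → EReal}, IsFree X s → IsFree X u → IsFree X v → u ≤ v →
    (∀ η, p η (s η) → w η = u η) → (∀ η, ¬ p η (s η) → w η = v η) → IsFree X w

lemma isGuard_le_zero (X : V) (e : Expr V) :
    IsGuard X fun η x => e.eval (Function.update η X x) ≤ 0 where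
  antitone η _ _ h := (eval_update_mono e X η h).trans
  isFree hs := (hs.eval_update e).of_le_zero

lemma isGuard_lt_zero (X : V) (e : Expr V) :
    IsGuard X fun η x => e.eval (Function.update η X x) < 0 where
  antitone η _ _ h := (eval_update_mono e X η h).trans_lt
  isFree hs := (hs.eval_update e).of_lt_zero

/-- Decision trees whose leaves are lattice combinations of affine families and in which the
first branch of each decision lies below the second one. -/
inductive IsCondTree (X : V) : Family V → Prop
  | leaf {g : Family V} : g ∈ latticeClosure {t | IsAtom X t} → IsCondTree X g
  | node {p : (V → EReal) → EReal → Prop} {f g h : Family V} : IsGuard X p →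
      IsCondTree X f → IsCondTree X g → f ≤ g → (∀ η x, p η x → h η x = f η x) →
      (∀ η x, ¬ p η x → h η x = g η x) → IsCondTree X h

lemma IsCondTree.isSolvable {X : V} {g : Family V} (hg : IsCondTree X g) : IsSolvable X g := by
  induction hg with
  | leaf hg => exact isSolvable_of_mem_latticeClosure hg
  | @node p f g h hp _ _ hfg hf hg ihf ihg =>
    have hm : ∀ η, Monotone (h η) := by
      intro η x y hxy
      by_cases hy : p η y
      · rw [hf η y hy, hf η x (hp.antitone η x y hxy hy)]
        exact ihf.monotone η hxy
      · rw [hg η y hy]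
        exact ((between_of_cases (hfg η) (hf η) (hg η)).2 x).trans (ihg.monotone η hxy)
    have hμ := fun η => leastFP_cases (hp.antitone η) (hfg η) (ihf.monotone η) (hm η)
      (hf η) (hg η)
    have hν := fun η => greatestFP_cases (hp.antitone η) (hfg η) (ihg.monotone η) (hm η)
      (hf η) (hg η)
    exact ⟨hm,
      hp.isFree ihf.least ihf.least ihg.least (fun η => leastFP_mono (hfg η))
        (fun η => (hμ η).1) (fun η => (hμ η).2),
      hp.isFree ihg.greatest ihf.greatest ihg.greatest (fun η => greatestFP_mono (hfg η))
        (fun η => (hν η).1) (fun η => (hν η).2)⟩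

section Map

variable {X : V} {φ : EReal → EReal → EReal}

lemma map₂_mem_latticeClosure (hφ : ∀ {a a' b b'}, a ≤ a' → b ≤ b' → φ a b ≤ φ a' b')
    (hat : ∀ {s t : Family V}, IsAtom X s → IsAtom X t →
      (fun η x => φ (s η x) (t η x)) ∈ latticeClosure {t : Family V | IsAtom X t})
    {f g : Family V} (hf : f ∈ latticeClosure {t | IsAtom X t})
    (hg : g ∈ latticeClosure {t | IsAtom X t}) :
    (fun η x => φ (f η x) (g η x)) ∈ latticeClosure {t | IsAtom X t} := by
  have hL : IsSublattice (latticeClosure {t : Family V | IsAtom X t}) :=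
    isSublattice_latticeClosure
  have h₁ : ∀ y, Monotone fun x => φ x y := fun y _ _ h => hφ h le_rfl
  have h₂ : ∀ x, Monotone (φ x) := fun x _ _ h => hφ le_rfl h
  induction hf using latticeClosure_sup_inf_induction with
  | mem s hs =>
    induction hg using latticeClosure_sup_inf_induction with
    | mem t ht => exact hat hs ht
    | sup a _ b _ ha hb =>
      convert hL.supClosed ha hb using 1
      ext η x
      exact (h₂ _).map_sup _ _
    | inf a _ b _ ha hb =>
      convert hL.infClosed ha hb using 1
      ext η x
      exact (h₂ _).map_inf _ _
  | sup a _ b _ ha hb =>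
    convert hL.supClosed ha hb using 1
    ext η x
    exact (h₁ _).map_sup _ _
  | inf a _ b _ ha hb =>
    convert hL.infClosed ha hb using 1
    ext η x
    exact (h₁ _).map_inf _ _

lemma IsCondTree.map₂ (hφ : ∀ {a a' b b'}, a ≤ a' → b ≤ b' → φ a b ≤ φ a' b')
    (hat : ∀ {s t : Family V}, IsAtom X s → IsAtom X t →
      (fun η x => φ (s η x) (t η x)) ∈ latticeClosure {t : Family V | IsAtom X t})
    {f g : Family V} (hf : IsCondTree X f) (hg : IsCondTree X g) :
    IsCondTree X fun η x => φ (f η x) (g η x) := by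
  induction hf with
  | leaf hf =>
    induction hg with
    | leaf hg => exact .leaf (map₂_mem_latticeClosure hφ hat hf hg)
    | node hp _ _ hfg hf hg ihf ihg =>
      exact .node hp ihf ihg (fun η x => hφ le_rfl (hfg η x))
        (fun η x h => congrArg _ (hf η x h)) (fun η x h => congrArg _ (hg η x h))
  | node hp _ _ hfg hf hg ihf ihg =>
    exact .node hp ihf ihg (fun η x => hφ (hfg η x) le_rfl)
      (fun η x h => congrArg (φ · _) (hf η x h)) (fun η x h => congrArg (φ · _) (hg η x h))

lemma IsCondTree.map {φ : EReal → EReal} (hφ : Monotone φ)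
    (hat : ∀ {t : Family V}, IsAtom X t →
      (fun η x => φ (t η x)) ∈ latticeClosure {t : Family V | IsAtom X t})
    {f : Family V} (hf : IsCondTree X f) : IsCondTree X fun η x => φ (f η x) :=
  hf.map₂ (φ := fun a _ => φ a) (fun h _ => hφ h) (fun h _ => hat h) hf

end Map

section Closure

variable {X : V} {s t f g : Family V}

lemma IsAtom.mem_latticeClosure (ht : IsAtom X t) : t ∈ latticeClosure {t | IsAtom X t} :=
  subset_latticeClosure ht

lemma IsAtom.scale_apply (c : {c : ℝ // 0 < c}) (ht : IsAtom X t) :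
    IsAtom X fun η x => c.1 * t η x := by
  cases ht with
  | const hr => exact .const (hr.scale c)
  | scale d hr =>
    simp only [scale_eadd, ← mul_assoc, ← EReal.coe_mul]
    exact .scale (c * d) (hr.scale c)
  | eqm hr =>
    simp only [scale_eadd, scale_eqNegInfVal]
    exact .eqm (hr.scale c)

lemma IsAtom.congr (ht : IsAtom X t) (h : ∀ η x, s η x = t η x) : IsAtom X s :=
  (funext₂ h : s = t) ▸ ht

lemma IsAtom.eadd (hs : IsAtom X s) (ht : IsAtom X t) :
    IsAtom X fun η x => eadd (s η x) (t η x) := by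
  cases hs with
  | const hr =>
    cases ht with
    | const hr' => exact .const (hr.add hr')
    | scale d hr' =>
      exact (IsAtom.scale d (hr'.add hr)).congr fun η x => by rw [eadd_comm, eadd_assoc]
    | eqm hr' =>
      exact (IsAtom.eqm (hr'.add hr)).congr fun η x => by rw [eadd_comm, eadd_assoc]
  | scale c hr =>
    cases ht with
    | const hr' =>
      exact (IsAtom.scale c (hr.add hr')).congr fun η x => by rw [eadd_assoc]
    | scale d hr' =>
      exact (IsAtom.scale (c + d) (hr.add hr')).congr fun η x => by
        rw [eadd_eadd_eadd_comm, eadd_scale]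
    | eqm hr' =>
      exact (IsAtom.eqm (hr.add hr')).congr fun η x => by
        rw [eadd_eadd_eadd_comm, eadd_scale_eqNegInfVal]
  | eqm hr =>
    cases ht with
    | const hr' =>
      exact (IsAtom.eqm (hr.add hr')).congr fun η x => by rw [eadd_assoc]
    | scale d hr' =>
      exact (IsAtom.eqm (hr.add hr')).congr fun η x => by
        rw [eadd_eadd_eadd_comm, eadd_comm (eqNegInfVal x), eadd_scale_eqNegInfVal]
    | eqm hr' =>
      exact (IsAtom.eqm (hr.add hr')).congr fun η x => by
        rw [eadd_eadd_eadd_comm, eadd_eqNegInfVal_self]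

lemma IsAtom.eqNegInfVal_mem (ht : IsAtom X t) :
    (fun η x => eqNegInfVal (t η x)) ∈ latticeClosure {t | IsAtom X t} := by
  have hL : IsSublattice (latticeClosure {t : Family V | IsAtom X t}) :=
    isSublattice_latticeClosure
  have hm : IsAtom X fun _ x => eqNegInfVal x := by
    simpa using IsAtom.eqm (IsFree.const 0)
  cases ht with
  | const hr => exact (IsAtom.const hr.eqm).mem_latticeClosure
  | scale c hr =>
    simp only [eqNegInfVal_eadd, eqNegInfVal_scale]
    exact hL.infClosed
      (hL.supClosed hm.mem_latticeClosure
        (IsAtom.const (hr.add (IsFree.const ⊥))).mem_latticeClosure)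
      (hL.supClosed (IsAtom.const hr.eqm).mem_latticeClosure
        (IsAtom.scale c (IsFree.const ⊥)).mem_latticeClosure)
  | eqm hr =>
    simp only [eqNegInfVal_eadd, eqNegInfVal_idem]
    exact hL.infClosed
      (hL.supClosed hm.mem_latticeClosure
        (IsAtom.const (hr.add (IsFree.const ⊥))).mem_latticeClosure)
      (hL.supClosed (IsAtom.const hr.eqm).mem_latticeClosure
        (IsAtom.eqm (IsFree.const ⊥)).mem_latticeClosure)

lemma IsCondTree.sup (hf : IsCondTree X f) (hg : IsCondTree X g) :
    IsCondTree X fun η x => f η x ⊔ g η x :=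
  hf.map₂ sup_le_sup (fun hs ht => isSublattice_latticeClosure.supClosed
    hs.mem_latticeClosure ht.mem_latticeClosure) hg

lemma IsCondTree.inf (hf : IsCondTree X f) (hg : IsCondTree X g) :
    IsCondTree X fun η x => f η x ⊓ g η x :=
  hf.map₂ inf_le_inf (fun hs ht => isSublattice_latticeClosure.infClosed
    hs.mem_latticeClosure ht.mem_latticeClosure) hg

/-- Every expression is a decision tree in the unknown `X`. -/
lemma isCondTree_eval (X : V) (e : Expr V) :
    IsCondTree X fun η x => e.eval (Function.update η X x) := by
  induction e with
  | var Y =>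
    refine .leaf (IsAtom.mem_latticeClosure ?_)
    by_cases h : Y = X
    · subst h
      simpa [Expr.eval] using IsAtom.scale (X := Y) 1 (IsFree.const 0)
    · simpa [Expr.eval, h] using IsAtom.const (IsFree.var (Ne.symm h))
  | const d => exact .leaf (IsAtom.const (IsFree.const d)).mem_latticeClosure
  | scale c e ih =>
    exact ih.map (scale_mono c) fun ht => (ht.scale_apply c).mem_latticeClosure
  | add e₁ e₂ ih₁ ih₂ =>
    exact ih₁.map₂ eadd_le_eadd (fun hs ht => (hs.eadd ht).mem_latticeClosure) ih₂
  | emin e₁ e₂ ih₁ ih₂ => exact ih₁.inf ih₂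
  | emax e₁ e₂ ih₁ ih₂ => exact ih₁.sup ih₂
  | condL e₁ e₂ e₃ _ ih₂ ih₃ =>
    exact .node (isGuard_le_zero X e₁) (ih₂.inf ih₃) ih₃ (fun _ _ => inf_le_right)
      (fun _ _ h => if_pos h) (fun _ _ h => if_neg h)
  | condR e₁ e₂ e₃ _ ih₂ ih₃ =>
    exact .node (isGuard_lt_zero X e₁) ih₂ (ih₂.sup ih₃) (fun _ _ => le_sup_left)
      (fun _ _ h => if_pos h) (fun _ _ h => if_neg h)
  | eqm e ih => exact ih.map eqNegInfVal_mono IsAtom.eqNegInfVal_mem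

end Closure

/-! ### Real equation systems -/

lemma sol_mono (E : RES V) : Monotone (sol E) := by
  induction E with
  | nil => exact monotone_id
  | cons p E ih =>
    obtain ⟨σ, X, e⟩ := p
    intro η η' h
    have key : ∀ r, e.eval (sol E (Function.update η X r)) ≤
        e.eval (sol E (Function.update η' X r)) := fun r =>
      eval_mono e (ih (update_le_update_iff.2 ⟨le_rfl, fun Y _ => h Y⟩))
    cases σ with
    | mu => exact ih (update_le_update_iff.2 ⟨leastFP_mono key, fun Y _ => h Y⟩)
    | nu => exact ih (update_le_update_iff.2 ⟨greatestFP_mono key, fun Y _ => h Y⟩)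

lemma sol_apply_of_notMem_bnd {E : RES V} {X : V} (h : X ∉ bnd E) (η : V → EReal) :
    sol E η X = η X := by
  induction E generalizing η with
  | nil => rfl
  | cons p E ih =>
    obtain ⟨σ, Y, e⟩ := p
    simp only [bnd, List.map_cons, List.mem_cons, not_or] at h
    cases σ <;> exact (ih h.2 _).trans (Function.update_of_ne h.1 _ _)

/-- every fixed-point equation can be solved, i.e. replaced by an
equivalent equation whose right-hand side does not contain the bound variable. -/
theorem solve_single_equation (σ : FP) (X : V) (e : Expr V) :
    ∃ e' : Expr V, X ∉ e'.occ ∧ REquiv [(σ, X, e)] [(σ, X, e')] := by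
  have hsol := (isCondTree_eval X e).isSolvable
  have hsub : ∀ F : RES V, X ∉ bnd F → ∀ η x, e.eval (sol F (Function.update η X x)) =
      e.eval (Function.update (sol F (Function.update η X x)) X x) := by
    intro F hF η x
    have hx : sol F (Function.update η X x) X = x := by simp [sol_apply_of_notMem_bnd hF]
    have h := Function.update_eq_self X (sol F (Function.update η X x))
    rw [hx] at h
    rw [h]
  have hmono : ∀ (F : RES V) η y, Monotone fun x =>
      e.eval (Function.update (sol F (Function.update η X x)) X y) := fun F η y _ _ h =>
    eval_mono e (update_le_update_iff.2 ⟨le_rfl, fun Y _ => sol_mono F (Function.update_mono h) Y⟩)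
  cases σ with
  | mu =>
    obtain ⟨e', he', h⟩ := hsol.least
    refine ⟨e', he', fun F hF η => ?_⟩
    have hX : X ∉ bnd F := fun hX => (hF X hX).1 (by simp [bnd])
    have key := leastFP_diag (hmono F η) fun x => eval_update_mono e X _
    simp only [← h, ← hsub F hX] at key
    exact congrArg (fun r => sol F (Function.update η X r)) key
  | nu =>
    obtain ⟨e', he', h⟩ := hsol.greatest
    refine ⟨e', he', fun F hF η => ?_⟩
    have hX : X ∉ bnd F := fun hX => (hF X hX).1 (by simp [bnd])
    have key := greatestFP_diag (hmono F η) fun x => eval_update_mono e X _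
    simp only [← h, ← hsub F hX] at key
    exact congrArg (fun r => sol F (Function.update η X r)) key

end
end RESpaper
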